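/- arXiv:2105.01319 — 4 statements merged into one kernel-verified Lean document; each statement's English description precedes it below -/
import Mathlib

section
/- Let F be a field of characteristic p > 0, let a_1, ..., a_n ∈ F be such that {a_1, ..., a_n} is p-independent, and let b_1, ..., b_n ∈ F. Then the following are equivalent: (i) F^p(a_1, ..., a_n) = F^p(b_1, ..., b_n); (ii) span_F(d a_1, ..., d a_n) = span_F(d b_1, ..., d b_n) in Ω^1(F); (iii) d a_1 ∧ ... ∧ d a_n = x · d b_1 ∧ ... ∧ d b_n in Ω^n(F) for some x ∈ F^*. -/
set_option synthInstance.maxHeartbeats 1000000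
set_option maxHeartbeats 1000000

open ExteriorAlgebra

noncomputable section Preamble

variable (F : Type) [Field F] (p : ℕ)

/-- The subfield `F^{p^t}(C)` of `F` generated by the `p^t`-th powers and the set `C`. -/
def pClosureT (t : ℕ) (C : Set F) : Subfield F :=
  Subfield.closure ((Set.range fun x : F => x ^ p ^ t) ∪ C)

/-- The subfield `F^p(C)` of `F` generated by the `p`-th powers and the set `C`. -/
def pClosure (C : Set F) : Subfield F := pClosureT F p 1 C

/-- The degree `[B(A) : B]` for a subfield `B` of `F` and a subset `A ⊆ F`. -/
def relDeg (B : Subfield F) (A : Set F) : ℕ :=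
  Module.finrank B (IntermediateField.adjoin B A)

/-- `pdeg A = k`, i.e. `[F^p(A) : F^p] = p ^ k`. -/
def pDegEq (A : Set F) (k : ℕ) : Prop :=
  relDeg F (pClosure F p ∅) A = p ^ k

/-- A finite family `a : Fin n → F` is `p`-independent if `[F^p(a₁,…,aₙ) : F^p] = pⁿ`. -/
def pIndep {n : ℕ} (a : Fin n → F) : Prop :=
  pDegEq F p (Set.range a) n

/-- The exterior algebra of the absolute differential forms of `F`; the spaces `Ωⁿ(F)`
are its graded pieces and the wedge product is its multiplication. -/
abbrev ExtOmega := ExteriorAlgebra F (Ω[F⁄ℤ])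

/-- The differential `d a` of an element `a : F`, viewed in the exterior algebra. -/
def dform (a : F) : ExtOmega F :=
  ExteriorAlgebra.ι F (KaehlerDifferential.D ℤ F a)

/-- The space `Ωⁿ(F)` of `n`-differential forms, as a submodule of the exterior algebra;
it is `0` for `n < 0`. -/
def OmegaPow (n : ℤ) : Submodule F (ExtOmega F) :=
  if 0 ≤ n then ⋀[F]^(n.toNat) (Ω[F⁄ℤ]) else ⊥

/-- The wedge product `d a₁ ∧ … ∧ d aₙ` of the differentials of a family. -/
def dwedge {n : ℕ} (a : Fin n → F) : ExtOmega F :=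
  (List.ofFn fun i => dform F (a i)).prod

/-- The annihilator `annΩ^n_F(U)` of a set `U` of differential forms. -/
def annOmega (n : ℕ) (U : Set (ExtOmega F)) : Submodule F (ExtOmega F) :=
  OmegaPow F n ⊓ ⨅ u ∈ U, LinearMap.ker (LinearMap.mulRight F u)

/-- The logarithmic differential form `(dx₁/x₁) ∧ … ∧ (dxₙ/xₙ)`. -/
def logForm {n : ℕ} (x : Fin n → F) : ExtOmega F :=
  (List.ofFn fun i => ExteriorAlgebra.ι F ((x i)⁻¹ • KaehlerDifferential.D ℤ F (x i))).prod

/-- The group `ν_n(F)`, additively generated by the logarithmic differential forms;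
it is `0` for `n < 0`. -/
def nuPow (n : ℤ) : AddSubgroup (ExtOmega F) :=
  if 0 ≤ n then
    AddSubgroup.closure
      {ω | ∃ x : Fin n.toNat → F, (∀ i, x i ≠ 0) ∧ ω = logForm F x}
  else ⊥

/-- The annihilator `ann ν^n_F(U)`. -/
def annNu (n : ℕ) (U : Set (ExtOmega F)) : AddSubgroup (ExtOmega F) :=
  (annOmega F n U).toAddSubgroup ⊓ nuPow F n

/-- `η ∧ W` for a form `η` and a subspace `W`. -/
def wedgeL (η : ExtOmega F) (W : Submodule F (ExtOmega F)) : Submodule F (ExtOmega F) :=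
  W.map (LinearMap.mulLeft F η)

/-- The set `dS₁ ∧ … ∧ dSᵣ` for sets `S₁, …, Sᵣ ⊆ F`. -/
def dSet {r : ℕ} (S : Fin r → Set F) : Set (ExtOmega F) :=
  {ω | ∃ s : Fin r → F, (∀ i, s i ∈ S i) ∧ ω = dwedge F s}

/-- The additive subgroup `[dy₁/y₁ ∧ … ∧ dy_t/y_t ∣ yᵢ ∈ K^*] ∧ ν_m(F)` of `Ωⁿ(F)`
(for `n = t + m`). -/
def logWedgeNu (K : Set F) (t : ℕ) (m : ℤ) : AddSubgroup (ExtOmega F) :=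
  AddSubgroup.closure
    {ω | ∃ y : Fin t → F, (∀ i, y i ∈ K ∧ y i ≠ 0) ∧
      ∃ χ ∈ nuPow F m, ω = logForm F y * χ}

variable (E : Type) [Field E] [Algebra F E]

/-- The restriction map `Ω(F) → Ω(E)` on exterior algebras of differential forms,
induced by the inclusion `F ⊆ E`; it sends `d a` to `d a` and `x dа₁ ∧ … ∧ daₙ` to
the corresponding form over `E`. -/
def resMap : ExtOmega F →+* ExtOmega E :=
  letI : Algebra F (ExtOmega E) :=
    ((algebraMap E (ExtOmega E)).comp (algebraMap F E)).toAlgebra'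
      (fun c x => Algebra.commutes (algebraMap F E c) x)
  (ExteriorAlgebra.lift F ⟨{
      toFun := fun w =>
        ExteriorAlgebra.ι E (KaehlerDifferential.map ℤ ℤ F E w)
      map_add' := fun x y => by simp
      map_smul' := fun c x => by
        simp only [map_smul, RingHom.id_apply]
        rw [← algebraMap_smul E c (KaehlerDifferential.map ℤ ℤ F E x), map_smul,
          Algebra.smul_def, Algebra.smul_def]
        rfl },
    fun m => ExteriorAlgebra.ι_sq_zero _⟩).toRingHom

/-- The kernel `Ωⁿ(E/F)` of the restriction map `Ωⁿ(F) → Ωⁿ(E)`. -/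
def OmegaKer (n : ℕ) : Set (ExtOmega F) :=
  {ω | ω ∈ OmegaPow F n ∧ resMap F E ω = 0}

/-- The kernel `ν_n(E/F) = Ωⁿ(E/F) ∩ ν_n(F)`. -/
def nuKer (n : ℕ) : Set (ExtOmega F) :=
  OmegaKer F E n ∩ (nuPow F n : Set (ExtOmega F))

end Preamble

section LinearAlgebra

variable {K V : Type*} [Field K] [AddCommGroup V] [Module K V]

/-- The wedge product of a finite family of vectors is nonzero if and only if the family is
linearly independent. -/
theorem ExteriorAlgebra.ιMulti_ne_zero_iff_linearIndependent {n : ℕ} {v : Fin n → V} :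
    ιMulti K n v ≠ 0 ↔ LinearIndependent K v := by
  refine ⟨fun h => ?_, fun hv h => ?_⟩
  · by_contra hv
    exact h ((ιMulti K n).map_linearDependent v hv)
  · obtain ⟨g, hg⟩ := LinearMap.exists_extend
      (Module.Basis.span hv).equivFun.toLinearMap
    have hgv : ∀ i, g (v i) = Pi.single i 1 := fun i => by
      have hi := LinearMap.congr_fun hg (Module.Basis.span hv i)
      rw [LinearMap.comp_apply, Submodule.subtype_apply, Module.Basis.span_apply] at hi
      rw [hi]
      simp [Finsupp.single_eq_pi_single]
    have hdet := congrArg (liftAlternating (R := K) (M := V) (N := K)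
      (fun m => if hm : m = n then
        hm ▸ (Matrix.detRowAlternating (R := K) (n := Fin n)).compLinearMap g else 0)) h
    rw [liftAlternating_apply_ιMulti, map_zero] at hdet
    have hone : (fun i => g (v i)) = (1 : Matrix (Fin n) (Fin n) K) := by
      ext i j
      rw [hgv, Matrix.one_apply, Pi.single_apply]
      simp [eq_comm]
    simp only [dite_true, AlternatingMap.compLinearMap_apply] at hdet
    rw [hone] at hdet
    exact one_ne_zero (Matrix.det_one.symm.trans hdet)

/-- An alternating map evaluated on vectors of the span of a linearly independent family `v` of
the right length is a multiple of its value at `v`. -/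
theorem AlternatingMap.exists_eq_smul_of_mem_span {W : Type*} [AddCommGroup W] [Module K W]
    {n : ℕ} {v w : Fin n → V} (hv : LinearIndependent K v)
    (hw : ∀ i, w i ∈ Submodule.span K (Set.range v)) (f : V [⋀^Fin n]→ₗ[K] W) :
    ∃ x : K, f w = x • f v := by
  set e := Module.Basis.span hv
  have he : ∀ i, (e i : V) = v i := fun i =>
    congrArg Subtype.val (Module.Basis.span_apply hv i)
  have key : f.compLinearMap (Submodule.subtype _) =
      (LinearMap.toSpanSingleton K W (f v)).compAlternatingMap e.det := by
    refine Module.Basis.ext_alternating e fun i hi => ?_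
    let σ : Equiv.Perm (Fin n) := Equiv.ofBijective i (Finite.injective_iff_bijective.1 hi)
    change f.compLinearMap (Submodule.subtype _) (e ∘ σ) =
      (LinearMap.toSpanSingleton K W (f v)).compAlternatingMap e.det (e ∘ σ)
    rw [AlternatingMap.map_perm, AlternatingMap.map_perm]
    simp [e.det_self, he]
  exact ⟨e.det fun i => ⟨w i, hw i⟩,
    by simpa [Function.comp_def] using DFunLike.congr_fun key fun i => ⟨w i, hw i⟩⟩

/-- A linearly independent family and another family of the same length span the same subspace
if and only if their wedge products agree up to a nonzero scalar. -/
theorem LinearIndependent.span_eq_iff_ιMulti_eq_smul {n : ℕ} {v w : Fin n → V}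
    (hv : LinearIndependent K v) :
    Submodule.span K (Set.range v) = Submodule.span K (Set.range w) ↔
      ∃ x : K, x ≠ 0 ∧ ιMulti K n v = x • ιMulti K n w := by
  have hv0 := ιMulti_ne_zero_iff_linearIndependent.2 hv
  constructor
  · intro h
    have hw : LinearIndependent K w := by
      rw [linearIndependent_iff_card_eq_finrank_span] at hv ⊢
      rw [hv, Set.finrank, Set.finrank, h]
    obtain ⟨x, hx⟩ := AlternatingMap.exists_eq_smul_of_mem_span hw
      (fun i => h ▸ Submodule.subset_span (Set.mem_range_self i)) (ιMulti K n)
    refine ⟨x, ?_, hx⟩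
    rintro rfl
    exact hv0 (by rw [hx, zero_smul])
  · rintro ⟨x, hx, h⟩
    have hw : LinearIndependent K w := by
      rw [← ιMulti_ne_zero_iff_linearIndependent]
      intro hw
      exact hv0 (by rw [h, hw, smul_zero])
    have hle : Submodule.span K (Set.range v) ≤ Submodule.span K (Set.range w) := by
      rw [Submodule.span_le, Set.range_subset_iff]
      intro i
      by_contra hi
      have hc : LinearIndependent K (Fin.cons (v i) w : Fin (n + 1) → V) :=
        linearIndependent_finCons.2 ⟨hw, hi⟩
      have hd : ¬ LinearIndependent K (Fin.cons (v i) v : Fin (n + 1) → V) := fun hd =>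
        (linearIndependent_finCons.1 hd).2 (Submodule.subset_span (Set.mem_range_self i))
      rw [← ιMulti_ne_zero_iff_linearIndependent] at hc hd
      rw [not_not] at hd
      apply hc
      rw [ιMulti_succ_apply] at hd ⊢
      simp only [Fin.cons_zero, Matrix.vecTail, Function.comp_def, Fin.cons_succ] at hd ⊢
      rw [h, mul_smul_comm] at hd
      exact (smul_eq_zero.1 hd).resolve_left hx
    have := FiniteDimensional.span_of_finite K (Set.finite_range w)
    refine Submodule.eq_of_le_of_finrank_eq hle ?_
    rw [finrank_span_eq_card hv, finrank_span_eq_card hw]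

end LinearAlgebra

section Differentials

variable {F : Type} [Field F] {p : ℕ}

theorem pClosure_le_iff {C : Set F} {L : Subfield F} :
    pClosure F p C ≤ L ↔ (∀ y : F, y ^ p ∈ L) ∧ C ⊆ L := by
  rw [pClosure, pClosureT, Subfield.closure_le, Set.union_subset_iff, Set.range_subset_iff]
  simp

theorem pow_mem_pClosure (C : Set F) (y : F) : y ^ p ∈ pClosure F p C :=
  (pClosure_le_iff.1 le_rfl).1 y

theorem subset_pClosure (C : Set F) : C ⊆ pClosure F p C :=
  ((pClosure_le_iff (p := p)).1 le_rfl).2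

variable [Fact p.Prime]

theorem finrank_adjoin_le_pow {k : Subfield F} (hk : ∀ y : F, y ^ p ∈ k) (s : Finset F) :
    Module.finrank k (IntermediateField.adjoin k (s : Set F)) ≤ p ^ s.card := by
  classical
  have hp : p.Prime := Fact.out
  induction s using Finset.induction_on with
  | empty =>
    rw [Finset.coe_empty, IntermediateField.adjoin_empty, IntermediateField.finrank_bot]
    simp
  | insert x s hx ih =>
    rw [Finset.coe_insert, Set.insert_eq, IntermediateField.adjoin_union,
      Finset.card_insert_of_notMem hx, pow_succ']
    refine (IntermediateField.finrank_sup_le _ _).trans (Nat.mul_le_mul ?_ ih)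
    let q : Polynomial k := Polynomial.X ^ p - Polynomial.C ⟨x ^ p, hk x⟩
    have hq : q.Monic := Polynomial.monic_X_pow_sub_C _ hp.ne_zero
    have hqx : Polynomial.aeval x q = 0 := by
      simp only [q, map_sub, map_pow, Polynomial.aeval_X, Polynomial.aeval_C]
      exact sub_self _
    rw [IntermediateField.adjoin.finrank ⟨q, hq, hqx⟩]
    exact (Polynomial.natDegree_le_of_dvd (minpoly.dvd k x hqx) hq.ne_zero).trans
      (Polynomial.natDegree_X_pow_sub_C).le

variable [CharP F p]

/-- If a subfield `L` contains all `p`-th powers and is maximal among the subfields avoiding `x`,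
then `F = L(x)`. -/
theorem adjoin_simple_eq_top_of_maximal {L : Subfield F} (hL : ∀ y : F, y ^ p ∈ L) {x : F}
    (hx : x ∉ L) (hmax : ∀ M : Subfield F, L ≤ M → x ∉ M → M ≤ L) :
    IntermediateField.adjoin L {x} = ⊤ := by
  have hp : p.Prime := Fact.out
  have hirr : ∀ y ∉ L, Irreducible (Polynomial.X ^ p - Polynomial.C (⟨y ^ p, hL y⟩ : L)) := by
    intro y hy
    refine X_pow_sub_C_irreducible_of_prime hp fun z hz => hy ?_
    have hzy : (z : F) ^ p = y ^ p := congrArg Subtype.val hz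
    exact frobenius_inj F p hzy ▸ z.2
  have hroot : ∀ y, Polynomial.aeval y
      (Polynomial.X ^ p - Polynomial.C (⟨y ^ p, hL y⟩ : L)) = 0 := fun y => by
    simp only [map_sub, map_pow, Polynomial.aeval_X, Polynomial.aeval_C]
    exact sub_self _
  have hint : ∀ y : F, IsIntegral L y := fun y =>
    ⟨_, Polynomial.monic_X_pow_sub_C _ hp.ne_zero, hroot y⟩
  have hfin : ∀ y ∉ L, Module.finrank L (IntermediateField.adjoin L {y}) = p := by
    intro y hy
    rw [IntermediateField.adjoin.finrank (hint y), ← minpoly.eq_of_irreducible_of_monic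
      (hirr y hy) (hroot y) (Polynomial.monic_X_pow_sub_C _ hp.ne_zero),
      Polynomial.natDegree_X_pow_sub_C]
  have hsub : ∀ y ∈ L, ∀ M : IntermediateField L F, y ∈ M := fun y hy M =>
    M.algebraMap_mem ⟨y, hy⟩
  rw [eq_top_iff]
  intro y _
  by_cases hy : y ∈ L
  · exact hsub y hy _
  · have hxy : x ∈ IntermediateField.adjoin L {y} := by
      by_contra hxy
      exact hy (hmax (IntermediateField.adjoin L {y}).toSubfield
        (fun z hz => hsub z hz _) hxy (IntermediateField.mem_adjoin_simple_self L y))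
    have := IntermediateField.adjoin.finiteDimensional (hint y)
    rw [IntermediateField.eq_of_le_of_finrank_eq
      (IntermediateField.adjoin_simple_le_iff.2 hxy) ((hfin x hx).trans (hfin y hy).symm)]
    exact IntermediateField.mem_adjoin_simple_self L y

/-- If a subfield `K` contains all `p`-th powers and `x ∉ K`, then some derivation vanishing on `K`
does not vanish at `x`. -/
theorem exists_derivation_ne_zero {K : Subfield F} (hK : ∀ y : F, y ^ p ∈ K) {x : F}
    (hx : x ∉ K) :
    ∃ (M : Type) (_ : AddCommGroup M) (_ : Module F M) (D : Derivation ℤ F M),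
      (∀ y ∈ K, D y = 0) ∧ D x ≠ 0 := by
  obtain ⟨L, hKL, hLmax⟩ := zorn_le_nonempty₀ {L : Subfield F | x ∉ L} (fun c hc hchain M hM =>
    ⟨sSup c, fun h => by
      obtain ⟨N, hN, hxN⟩ := (Subfield.mem_sSup_of_directedOn ⟨M, hM⟩ hchain.directedOn).1 h
      exact hc hN hxN, fun _ => le_sSup⟩) K hx
  have hL : ∀ y : F, y ^ p ∈ L := fun y => hKL (hK y)
  have htop := adjoin_simple_eq_top_of_maximal hL hLmax.prop
    (fun M hLM hM => hLmax.le_of_ge hM hLM)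
  refine ⟨Ω[F⁄L], inferInstance, inferInstance, (KaehlerDifferential.D L F).restrictScalars ℤ,
    fun y hy => (KaehlerDifferential.D L F).map_algebraMap ⟨y, hKL hy⟩, fun h0 => ?_⟩
  replace h0 : KaehlerDifferential.D L F x = 0 := h0
  have hp : p.Prime := Fact.out
  have hint : IsIntegral L x := ⟨Polynomial.X ^ p - Polynomial.C ⟨x ^ p, hL x⟩,
    Polynomial.monic_X_pow_sub_C _ hp.ne_zero, by
      rw [← Polynomial.aeval_def]
      simp only [map_sub, map_pow, Polynomial.aeval_X, Polynomial.aeval_C]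
      exact sub_self _⟩
  have : FiniteDimensional L F := by
    have := IntermediateField.adjoin.finiteDimensional hint
    rw [htop] at this
    exact Module.Finite.equiv (IntermediateField.topEquiv (F := L) (E := F)).toLinearEquiv
  have hD : ∀ y : F, KaehlerDifferential.D L F y = 0 := by
    intro y
    have hy : y ∈ IntermediateField.adjoin L {x} := htop ▸ IntermediateField.mem_top
    induction hy using IntermediateField.adjoin_induction with
    | mem z hz => rwa [Set.mem_singleton_iff.1 hz]
    | algebraMap z => exact Derivation.map_algebraMap _ z
    | add y z _ _ hy hz => rw [map_add, hy, hz, add_zero]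
    | inv y _ hy => rw [Derivation.leibniz_inv, hy, smul_zero]
    | mul y z _ _ hy hz => rw [Derivation.leibniz, hy, hz, smul_zero, smul_zero, add_zero]
  have : Subsingleton (Ω[F⁄L]) := by
    rw [← Submodule.subsingleton_iff F, ← subsingleton_iff_bot_eq_top,
      ← KaehlerDifferential.span_range_derivation L F, eq_comm, Submodule.span_eq_bot]
    rintro _ ⟨y, rfl⟩
    exact hD y
  have : Algebra.FormallyUnramified L F := ⟨inferInstance⟩
  have hsep := Algebra.FormallyUnramified.isSeparable L F
  have : ExpChar L p := ExpChar.prime hp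
  have : IsPurelyInseparable L F := (isPurelyInseparable_iff_pow_mem L p).2 fun y =>
    ⟨1, ⟨y ^ p, hL y⟩, by rw [pow_one]; rfl⟩
  obtain ⟨z, hz⟩ := IsPurelyInseparable.inseparable L x (hsep.isSeparable L x)
  exact hLmax.prop (hz ▸ z.2)

/-- The differential `dx` lies in the span of the differentials of the elements of `C` if and only
if `x ∈ F^p(C)`. -/
theorem D_mem_span_iff_mem_pClosure {C : Set F} {x : F} :
    KaehlerDifferential.D ℤ F x ∈ Submodule.span F (KaehlerDifferential.D ℤ F '' C) ↔
      x ∈ pClosure F p C := by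
  constructor
  · intro h
    by_contra hx
    obtain ⟨M, _, _, D, hD, hDx⟩ := exists_derivation_ne_zero (pow_mem_pClosure C) hx
    refine hDx ?_
    rw [← D.liftKaehlerDifferential_comp_D]
    have hle : Submodule.span F (KaehlerDifferential.D ℤ F '' C) ≤
        LinearMap.ker D.liftKaehlerDifferential := by
      rw [Submodule.span_le]
      rintro _ ⟨y, hy, rfl⟩
      simpa using hD y (subset_pClosure C hy)
    exact hle h
  · intro h
    refine Subfield.closure_induction
      (p := fun y _ => KaehlerDifferential.D ℤ F y ∈
        Submodule.span F (KaehlerDifferential.D ℤ F '' C)) ?_ ?_ ?_ ?_ ?_ ?_ h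
    · rintro _ (⟨y, rfl⟩ | hy)
      · simp [Derivation.leibniz_pow, ← Nat.cast_smul_eq_nsmul F]
      · exact Submodule.subset_span ⟨_, hy, rfl⟩
    · simp
    · intro y z _ _ hy hz
      rw [map_add]
      exact add_mem hy hz
    · intro y _ hy
      rw [map_neg]
      exact neg_mem hy
    · intro y _ hy
      rw [Derivation.leibniz_inv]
      exact Submodule.smul_mem _ _ hy
    · intro y z _ _ hy hz
      rw [Derivation.leibniz]
      exact add_mem (Submodule.smul_mem _ _ hz) (Submodule.smul_mem _ _ hy)

theorem span_D_le_iff_pClosure_le {A B : Set F} :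
    Submodule.span F (KaehlerDifferential.D ℤ F '' A) ≤
        Submodule.span F (KaehlerDifferential.D ℤ F '' B) ↔
      pClosure F p A ≤ pClosure F p B := by
  rw [Submodule.span_le, Set.image_subset_iff, pClosure_le_iff]
  exact ⟨fun h => ⟨pow_mem_pClosure B, fun x hx => D_mem_span_iff_mem_pClosure.1 (h hx)⟩,
    fun h x hx => D_mem_span_iff_mem_pClosure.2 (h.2 hx)⟩

/-- The differentials of a `p`-independent family are linearly independent. -/
theorem pIndep.linearIndependent_D {n : ℕ} {a : Fin n → F} (ha : pIndep F p a) :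
    LinearIndependent F fun i => KaehlerDifferential.D ℤ F (a i) := by
  classical
  rw [linearIndependent_iff_notMem_span]
  intro i hi
  set s : Finset F := (Finset.univ.erase i).image a
  have hs : (s : Set F) = a '' (Set.univ \ {i}) := by
    ext; simp [s]
  have hmem : a i ∈ pClosure F p (s : Set F) := by
    rw [← D_mem_span_iff_mem_pClosure, hs, Set.image_image]
    exact hi
  set k := pClosure F p (∅ : Set F)
  have hadj : IntermediateField.adjoin k (Set.range a) ≤
      IntermediateField.adjoin k (s : Set F) := by
    rw [IntermediateField.adjoin_le_iff]
    rintro _ ⟨j, rfl⟩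
    by_cases hj : j = i
    · subst hj
      refine (pClosure_le_iff (L := (IntermediateField.adjoin k (s : Set F)).toSubfield)).2
        ⟨fun y => ?_, IntermediateField.subset_adjoin k _⟩ hmem
      exact (IntermediateField.adjoin k (s : Set F)).algebraMap_mem
        ⟨y ^ p, pow_mem_pClosure ∅ y⟩
    · exact IntermediateField.subset_adjoin k _ (by rw [hs]; exact ⟨j, by simpa using hj, rfl⟩)
  have heq : IntermediateField.adjoin k (Set.range a) = IntermediateField.adjoin k (s : Set F) :=
    le_antisymm hadj (IntermediateField.adjoin.mono _ _ _ (hs ▸ Set.image_subset_range _ _))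
  have hle := finrank_adjoin_le_pow (pow_mem_pClosure (p := p) (∅ : Set F)) s
  rw [← heq] at hle
  have hcard : s.card < n := Finset.card_image_le.trans_lt (by
    simpa using Finset.card_erase_lt_of_mem (Finset.mem_univ i))
  exact (hle.trans_lt (Nat.pow_lt_pow_right (Fact.out : p.Prime).one_lt hcard)).ne ha

end Differentials

/-- Lemma 2.1(b). For a `p`-independent family `a₁, …, aₙ` and any
`b₁, …, bₙ ∈ F` the following are equivalent: (i) `F^p(a₁,…,aₙ) = F^p(b₁,…,bₙ)`;
(ii) `span_F(da₁,…,daₙ) = span_F(db₁,…,dbₙ)`; (iii) `da₁ ∧ … ∧ daₙ = x · db₁ ∧ … ∧ dbₙ`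
for some `x ∈ F^*`. -/
theorem stmt1 (F : Type) [Field F] (p : ℕ) [Fact p.Prime] [CharP F p]
    (n : ℕ) (a b : Fin n → F) (ha : pIndep F p a) :
    List.TFAE [pClosure F p (Set.range a) = pClosure F p (Set.range b),
      Submodule.span F (Set.range fun i => KaehlerDifferential.D ℤ F (a i)) =
        Submodule.span F (Set.range fun i => KaehlerDifferential.D ℤ F (b i)),
      ∃ x : F, x ≠ 0 ∧ dwedge F a = x • dwedge F b] := by
  have hrange : ∀ c : Fin n → F, (Set.range fun i => KaehlerDifferential.D ℤ F (c i)) =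
      KaehlerDifferential.D ℤ F '' Set.range c := fun c => Set.range_comp _ c
  tfae_have 1 ↔ 2 := by
    rw [hrange, hrange, le_antisymm_iff, le_antisymm_iff, span_D_le_iff_pClosure_le (p := p),
      span_D_le_iff_pClosure_le (p := p)]
  tfae_have 2 ↔ 3 := ha.linearIndependent_D.span_eq_iff_ιMulti_eq_smul
  tfae_finish
end

section
/- Let F be a field of characteristic p > 0 and let a, b_1, ..., b_n ∈ F. Then d a lies in the F-linear span of d b_1, ..., d b_n in Ω^1(F) if and only if a ∈ F^p(b_1, ..., b_n). -/
set_option synthInstance.maxHeartbeats 1000000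
set_option maxHeartbeats 1000000

open ExteriorAlgebra

namespace Derivation

/-- The elements of a field that a derivation sends into a given submodule form a subfield. -/
def subfieldComap {R K M : Type*} [CommRing R] [Field K] [Algebra R K] [AddCommGroup M]
    [Module K M] [Module R M] (D : Derivation R K M) (N : Submodule K M) : Subfield K where
  carrier := {x | D x ∈ N}
  zero_mem' := by simp
  one_mem' := by simp
  add_mem' {x y} (hx : D x ∈ N) (hy : D y ∈ N) := by
    simpa using N.add_mem hx hy
  neg_mem' {x} (hx : D x ∈ N) := by simpa using hx
  mul_mem' {x y} (hx : D x ∈ N) (hy : D y ∈ N) := by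
    simpa using N.add_mem (N.smul_mem x hy) (N.smul_mem y hx)
  inv_mem' x (hx : D x ∈ N) := by
    simpa [D.leibniz_inv] using N.smul_mem _ hx

theorem mem_subfieldComap {R K M : Type*} [CommRing R] [Field K] [Algebra R K] [AddCommGroup M]
    [Module K M] [Module R M] {D : Derivation R K M} {N : Submodule K M} {x : K} :
    x ∈ D.subfieldComap N ↔ D x ∈ N :=
  Iff.rfl

theorem map_pow_char {R K M : Type*} [CommRing R] [Field K] [Algebra R K] [AddCommGroup M]
    [Module K M] [Module R M] (D : Derivation R K M) (p : ℕ) [CharP K p] (x : K) :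
    D (x ^ p) = 0 := by
  rw [D.leibniz_pow, ← Nat.cast_smul_eq_nsmul K, CharP.cast_eq_zero, zero_smul]

end Derivation

/-- A subfield not containing `a` is contained in a maximal one. -/
theorem Subfield.exists_le_maximal_notMem {K : Type*} [Field K] {S : Subfield K} {a : K}
    (ha : a ∉ S) : ∃ L : Subfield K, S ≤ L ∧ Maximal (fun T : Subfield K => a ∉ T) L := by
  refine zorn_le_nonempty₀ {T : Subfield K | a ∉ T} (fun c hc hchain y hy => ?_) S ha
  refine ⟨sSup c, fun h => ?_, fun z hz => le_sSup hz⟩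
  obtain ⟨T, hT, haT⟩ := (Subfield.mem_sSup_of_directedOn ⟨y, hy⟩ hchain.directedOn).1 h
  exact hc hT haT

namespace Subfield

variable {K : Type*} [Field K] (p : ℕ) [Fact p.Prime] [CharP K p]

theorem finrank_adjoin_simple_of_pow_mem {L : Subfield K} {x : K} (hx : x ∉ L)
    (hxp : x ^ p ∈ L) : Module.finrank L (IntermediateField.adjoin L {x}) = p := by
  have hp : p.Prime := Fact.out
  have hirr : Irreducible (Polynomial.X ^ p - Polynomial.C (⟨x ^ p, hxp⟩ : L)) := by
    refine X_pow_sub_C_irreducible_of_prime hp fun b hb => hx ?_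
    have h : (b : K) ^ p = x ^ p := congrArg Subtype.val hb
    rw [← frobenius_inj K p h]
    exact b.2
  have hmonic := Polynomial.monic_X_pow_sub_C (⟨x ^ p, hxp⟩ : L) hp.ne_zero
  have hroot : Polynomial.aeval x (Polynomial.X ^ p - Polynomial.C (⟨x ^ p, hxp⟩ : L)) = 0 := by
    simp only [map_sub, map_pow, Polynomial.aeval_X, Polynomial.aeval_C]
    exact sub_self (x ^ p)
  have hmin := minpoly.eq_of_irreducible_of_monic hirr hroot hmonic
  have hint : IsIntegral L x := ⟨_, hmonic, hroot⟩
  rw [IntermediateField.adjoin.finrank hint, ← hmin, Polynomial.natDegree_X_pow_sub_C]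

theorem adjoin_simple_eq_top_of_maximal_notMem {L : Subfield K} {a : K}
    (hL : Maximal (fun T : Subfield K => a ∉ T) L) (hpow : ∀ x : K, x ^ p ∈ L) :
    IntermediateField.adjoin L {a} = ⊤ := by
  have hp : p.Prime := Fact.out
  refine eq_top_iff.2 fun x _ => ?_
  by_cases hx : x ∈ L
  · exact (IntermediateField.adjoin L {a}).algebraMap_mem ⟨x, hx⟩
  have hxa : a ∈ IntermediateField.adjoin L {x} := by
    by_contra h
    refine hx (hL.le_of_ge (y := (IntermediateField.adjoin L {x}).toSubfield) h (fun y hy => ?_) ?_)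
    · exact (IntermediateField.adjoin L {x}).algebraMap_mem ⟨y, hy⟩
    · exact IntermediateField.mem_adjoin_simple_self L x
  have hfx := finrank_adjoin_simple_of_pow_mem p hx (hpow x)
  have : FiniteDimensional L (IntermediateField.adjoin L {x}) :=
    Module.finite_of_finrank_pos (hfx ▸ hp.pos)
  rw [IntermediateField.eq_of_le_of_finrank_eq
    (IntermediateField.adjoin_simple_le_iff.2 hxa)
    ((finrank_adjoin_simple_of_pow_mem p hL.prop (hpow a)).trans hfx.symm)]
  exact IntermediateField.mem_adjoin_simple_self L x

theorem D_ne_zero_of_maximal_notMem {L : Subfield K} {a : K}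
    (hL : Maximal (fun T : Subfield K => a ∉ T) L) (hpow : ∀ x : K, x ^ p ∈ L) :
    KaehlerDifferential.D L K a ≠ 0 := by
  intro h0
  have hp : p.Prime := Fact.out
  have htop := adjoin_simple_eq_top_of_maximal_notMem p hL hpow
  have hfin : FiniteDimensional L K := by
    refine Module.finite_of_finrank_pos ?_
    rw [← IntermediateField.finrank_top', ← htop,
      finrank_adjoin_simple_of_pow_mem p hL.prop (hpow a)]
    exact hp.pos
  have hD (x : K) : KaehlerDifferential.D L K x = 0 := by
    have hx : x ∈ IntermediateField.adjoin L {a} := htop ▸ IntermediateField.mem_top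
    have hle : IntermediateField.adjoin L {a} ≤
        ((KaehlerDifferential.D L K).subfieldComap ⊥).toIntermediateField fun y => by
          simp [Derivation.mem_subfieldComap] :=
      IntermediateField.adjoin_simple_le_iff.2 ((Submodule.mem_bot K).2 h0)
    exact (Submodule.mem_bot K).1 (hle hx)
  have hsub : Subsingleton (Ω[K⁄L]) := by
    refine (Submodule.subsingleton_iff K).1 (subsingleton_of_bot_eq_top ?_)
    rw [← KaehlerDifferential.span_range_derivation, eq_comm, Submodule.span_eq_bot]
    rintro _ ⟨x, rfl⟩
    exact hD x
  have : Algebra.FormallyUnramified L K := ⟨hsub⟩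
  have : IsPurelyInseparable L K :=
    (isPurelyInseparable_iff_pow_mem L p).2 fun x => ⟨1, ⟨x ^ p, hpow x⟩, by simp; rfl⟩
  obtain ⟨y, hy⟩ : a ∈ (algebraMap L K).range :=
    Algebra.FormallyUnramified.range_eq_top_of_isPurelyInseparable L K ▸ Subring.mem_top a
  exact hL.prop (hy ▸ y.2)

end Subfield

/-- Lemma 2.1(c). `d a ∈ span_F(d b₁, …, d bₙ)` if and only if
`a ∈ F^p(b₁, …, bₙ)`. -/
theorem stmt2 (F : Type) [Field F] (p : ℕ) [Fact p.Prime] [CharP F p]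
    (n : ℕ) (a : F) (b : Fin n → F) :
    KaehlerDifferential.D ℤ F a ∈
        Submodule.span F (Set.range fun i => KaehlerDifferential.D ℤ F (b i)) ↔
      a ∈ pClosure F p (Set.range b) := by
  have hD (S : Set F) : pClosure F p S ≤ (KaehlerDifferential.D ℤ F).subfieldComap
      (Submodule.span F (KaehlerDifferential.D ℤ F '' S)) := by
    refine Subfield.closure_le.2 (Set.union_subset ?_ fun x hx => ?_)
    · rintro _ ⟨x, rfl⟩
      simp only [pow_one, SetLike.mem_coe, Derivation.mem_subfieldComap,
        Derivation.map_pow_char, zero_mem]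
    · exact Submodule.subset_span (Set.mem_image_of_mem _ hx)
  refine ⟨fun ha => ?_, fun ha => ?_⟩
  · by_contra hmem
    obtain ⟨L, hle, hL⟩ := Subfield.exists_le_maximal_notMem hmem
    refine Subfield.D_ne_zero_of_maximal_notMem p hL (fun x => hle (Subfield.subset_closure
      (Or.inl ⟨x, by simp⟩))) ?_
    have hspan : Submodule.span F (Set.range fun i => KaehlerDifferential.D ℤ F (b i)) ≤
        LinearMap.ker (KaehlerDifferential.map ℤ L F F) := by
      refine Submodule.span_le.2 ?_
      rintro _ ⟨i, rfl⟩
      have hbi : b i ∈ L := hle (Subfield.subset_closure (Or.inr ⟨i, rfl⟩))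
      have h0 : KaehlerDifferential.D L F (b i) = 0 :=
        (KaehlerDifferential.D L F).map_algebraMap ⟨b i, hbi⟩
      simpa using h0
    simpa using hspan ha
  · have h := hD _ ha
    rwa [Derivation.mem_subfieldComap, ← Set.range_comp] at h
end

section
/- Let F be a field of characteristic p > 0, let {b_1, ..., b_r} ⊆ F be p-independent, and let ω ∈ Ω^n(F). Then d b_i divides ω for every i = 1, ..., r if and only if d b_1 ∧ ... ∧ d b_r divides ω; here, for η ∈ Ω^s(F), we say η divides ω if there exists v ∈ Ω^{n−s}(F) with ω = η ∧ v. -/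
set_option synthInstance.maxHeartbeats 1000000
set_option maxHeartbeats 1000000

open ExteriorAlgebra

open IntermediateField Polynomial in
/-- If `y ^ p` lies in a field `K` of characteristic `p` but `y` does not, then `X ^ p - y ^ p`
is the minimal polynomial of `y` over `K`. -/
theorem minpoly_eq_X_pow_sub_C_of_notMem_range {K L : Type*} [Field K] [Field L] [Algebra K L]
    (p : ℕ) [hp : Fact p.Prime] [CharP L p] {a : K} {y : L} (ha : algebraMap K L a = y ^ p)
    (hy : y ∉ Set.range (algebraMap K L)) : minpoly K y = X ^ p - C a := by
  refine (minpoly.eq_of_irreducible_of_monic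
    (X_pow_sub_C_irreducible_of_prime hp.out fun c hc => hy ⟨c, ?_⟩) (by simp [ha])
    (monic_X_pow_sub_C a hp.out.ne_zero)).symm
  apply frobenius_inj L p
  simp only [frobenius_def]
  rw [← map_pow, hc, ha]

open IntermediateField Polynomial in
theorem finrank_adjoin_simple_eq_of_pow_mem_range {K L : Type*} [Field K] [Field L] [Algebra K L]
    (p : ℕ) [hp : Fact p.Prime] [CharP L p] {y : L} (ha : y ^ p ∈ Set.range (algebraMap K L))
    (hy : y ∉ Set.range (algebraMap K L)) : Module.finrank K K⟮y⟯ = p := by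
  obtain ⟨a, ha⟩ := ha
  have hm := minpoly_eq_X_pow_sub_C_of_notMem_range p ha hy
  have hi : IsIntegral K y := by
    refine ⟨X ^ p - C a, monic_X_pow_sub_C a hp.out.ne_zero, by simp [ha]⟩
  rw [adjoin.finrank hi, hm, natDegree_X_pow_sub_C]

open IntermediateField in
theorem finrank_adjoin_finset_le_of_pow_mem_range {K L : Type*} [Field K] [Field L] [Algebra K L]
    (p : ℕ) [hp : Fact p.Prime] [CharP L p] (hpow : ∀ y : L, y ^ p ∈ Set.range (algebraMap K L))
    (S : Finset L) : Module.finrank K (adjoin K (S : Set L)) ≤ p ^ S.card := by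
  classical
  induction S using Finset.induction_on with
  | empty =>
    rw [Finset.coe_empty, adjoin_empty, IntermediateField.finrank_bot, Finset.card_empty, pow_zero]
  | insert y S hy ih =>
    rw [Finset.coe_insert, Set.insert_eq, adjoin_union, Finset.card_insert_of_notMem hy, pow_succ']
    refine (finrank_sup_le _ _).trans (Nat.mul_le_mul ?_ ih)
    by_cases h : y ∈ Set.range (algebraMap K L)
    · rw [finrank_adjoin_simple_eq_one_iff.mpr (IntermediateField.mem_bot.mpr h)]
      exact hp.out.one_le
    · exact (finrank_adjoin_simple_eq_of_pow_mem_range p (hpow y) h).le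

/-- A subfield maximal among those containing `L` and missing `x`. -/
theorem Subfield.exists_maximal_notMem {F : Type*} [Field F] (L : Subfield F) {x : F}
    (hx : x ∉ L) : ∃ M : Subfield F, L ≤ M ∧ x ∉ M ∧ ∀ N : Subfield F, M < N → x ∈ N := by
  obtain ⟨M, hLM, hM⟩ := zorn_le_nonempty₀ {S : Subfield F | x ∉ S} (fun c hc hchain y hy => by
    refine ⟨sSup c, ?_, fun z hz => le_sSup hz⟩
    intro hmem
    obtain ⟨s, hs, hxs⟩ :=
      (Subfield.mem_sSup_of_directedOn ⟨y, hy⟩ hchain.directedOn).mp hmem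
    exact hc hs hxs) L hx
  refine ⟨M, hLM, hM.prop, fun N hN => ?_⟩
  by_contra h
  exact hN.not_ge (hM.le_of_ge h hN.le)

open IntermediateField in
/-- If `L` contains all `p`-th powers and `x ∉ L`, then the differential of `x` relative to some
larger subfield does not vanish. -/
theorem exists_subfield_D_ne_zero {F : Type*} [Field F] (p : ℕ) [hp : Fact p.Prime] [CharP F p]
    (L : Subfield F) (hpow : ∀ y : F, y ^ p ∈ L) {x : F} (hx : x ∉ L) :
    ∃ M : Subfield F, L ≤ M ∧ KaehlerDifferential.D M F x ≠ 0 := by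
  obtain ⟨M, hLM, hxM, hmax⟩ := L.exists_maximal_notMem hx
  refine ⟨M, hLM, fun hD => ?_⟩
  have hpM (y : F) : y ^ p ∈ Set.range (algebraMap M F) := ⟨⟨y ^ p, hLM (hpow y)⟩, rfl⟩
  have hnot {y : F} (hy : y ∉ M) : y ∉ Set.range (algebraMap M F) := by
    rintro ⟨z, rfl⟩
    exact hy z.2
  have hint (y : F) : IsIntegral M y := by
    obtain ⟨a, ha⟩ := hpM y
    exact .of_pow hp.out.pos (ha ▸ isIntegral_algebraMap)
  have htop : M⟮x⟯ = ⊤ := by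
    refine top_le_iff.mp fun y _ => ?_
    by_cases hy : y ∈ M
    · exact M⟮x⟯.algebraMap_mem ⟨y, hy⟩
    have hxy : x ∈ M⟮y⟯ := by
      refine hmax M⟮y⟯.toSubfield (lt_of_le_of_ne (fun z hz => M⟮y⟯.algebraMap_mem ⟨z, hz⟩) ?_)
      intro h
      apply hy
      rw [h]
      exact mem_adjoin_simple_self M y
    have := adjoin.finiteDimensional (hint y)
    rw [eq_of_le_of_finrank_eq (adjoin_simple_le_iff.mpr hxy)
      ((finrank_adjoin_simple_eq_of_pow_mem_range p (hpM x) (hnot hxM)).trans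
        (finrank_adjoin_simple_eq_of_pow_mem_range p (hpM y) (hnot hy)).symm)]
    exact mem_adjoin_simple_self M y
  have hadj : Algebra.adjoin M {x} = ⊤ := by
    rw [← adjoin_simple_toSubalgebra_of_isAlgebraic (hint x).isAlgebraic, htop]
    rfl
  have hfin : FiniteDimensional M F := by
    have := adjoin.finiteDimensional (hint x)
    rw [htop] at this
    exact Module.Finite.equiv (topEquiv (F := M) (E := F)).toLinearEquiv
  have hD0 : KaehlerDifferential.D M F = 0 := by
    refine Derivation.ext_of_adjoin_eq_top {x} hadj ?_
    rintro _ rfl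
    simpa using hD
  have hsub : Subsingleton Ω[F⁄M] := by
    rw [← Submodule.subsingleton_iff F, ← subsingleton_iff_bot_eq_top,
      ← KaehlerDifferential.span_range_derivation, hD0]
    symm
    rw [Submodule.span_eq_bot]
    rintro _ ⟨y, rfl⟩
    rfl
  have hsep : Algebra.IsSeparable M F :=
    (Algebra.FormallyUnramified.iff_isSeparable M F).mp
      ((Algebra.formallyUnramified_iff M F).mpr hsub)
  have := Algebra.IsSeparable.isSeparable M x
  obtain ⟨a, ha⟩ := hpM x
  have hM : CharP M p := (algebraMap M F).charP_iff (algebraMap M F).injective p |>.mpr ‹_›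
  rw [IsSeparable, minpoly_eq_X_pow_sub_C_of_notMem_range p ha (hnot hxM),
    Polynomial.separable_def] at this
  have hu : IsUnit (Polynomial.X ^ p - Polynomial.C a) := by
    simpa [Polynomial.derivative_X_pow, isCoprime_zero_right] using this
  exact hp.out.ne_zero (by
    simpa using (Polynomial.natDegree_X_pow_sub_C (n := p) (r := a)).symm.trans
      (Polynomial.natDegree_eq_zero_of_isUnit hu))

open IntermediateField in
theorem pIndep.notMem_adjoin_image_compl {F : Type} [Field F] {p : ℕ} [hp : Fact p.Prime]
    [CharP F p] {r : ℕ} {b : Fin r → F} (hb : pIndep F p b) (k : Fin r) :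
    b k ∉ adjoin (pClosure F p ∅) (b '' {k}ᶜ) := by
  classical
  intro hk
  have hpow (y : F) : y ^ p ∈ Set.range (algebraMap (pClosure F p ∅) F) :=
    ⟨⟨y ^ p, Subfield.subset_closure (Or.inl ⟨y, by simp⟩)⟩, rfl⟩
  have hadj : adjoin (pClosure F p ∅) (Set.range b) = adjoin (pClosure F p ∅) (b '' {k}ᶜ) := by
    refine le_antisymm (adjoin_le_iff.mpr ?_) (adjoin.mono _ _ _ (Set.image_subset_range _ _))
    rintro _ ⟨j, rfl⟩
    by_cases hj : j = k
    · exact hj ▸ hk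
    · exact subset_adjoin _ _ ⟨j, hj, rfl⟩
  have hle := finrank_adjoin_finset_le_of_pow_mem_range p hpow (({k}ᶜ : Finset (Fin r)).image b)
  have hcard : (({k}ᶜ : Finset (Fin r)).image b).card < r := by
    refine Finset.card_image_le.trans_lt ?_
    rw [Finset.card_compl, Finset.card_singleton, Fintype.card_fin]
    have := k.pos
    omega
  have hb' : Module.finrank (pClosure F p ∅) (adjoin (pClosure F p ∅) (Set.range b)) = p ^ r := hb
  rw [Finset.coe_image, Finset.coe_compl, Finset.coe_singleton, ← hadj, hb'] at hle
  exact (Nat.pow_lt_pow_right hp.out.one_lt hcard).not_ge hle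

/-- The differentials of a `p`-independent family have a dual family of functionals. -/
theorem pIndep.exists_dual {F : Type} [Field F] {p : ℕ} [hp : Fact p.Prime]
    [CharP F p] {r : ℕ} {b : Fin r → F} (hb : pIndep F p b) (k : Fin r) :
    ∃ f : Module.Dual F (Ω[F⁄ℤ]), f (KaehlerDifferential.D ℤ F (b k)) = 1 ∧
      ∀ j ≠ k, f (KaehlerDifferential.D ℤ F (b j)) = 0 := by
  set L := (IntermediateField.adjoin (pClosure F p ∅) (b '' {k}ᶜ)).toSubfield
  have hpow (y : F) : y ^ p ∈ L :=
    (IntermediateField.adjoin (pClosure F p ∅) (b '' {k}ᶜ)).algebraMap_mem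
      ⟨y ^ p, Subfield.subset_closure (Or.inl ⟨y, by simp⟩)⟩
  obtain ⟨M, hLM, hM⟩ := exists_subfield_D_ne_zero p L hpow (hb.notMem_adjoin_image_compl k)
  obtain ⟨g, hg⟩ : ∃ g : Module.Dual F (Ω[F⁄M]), g (KaehlerDifferential.D M F (b k)) ≠ 0 := by
    by_contra! h
    exact hM ((Module.forall_dual_apply_eq_zero_iff F _).mp h)
  refine ⟨(g (KaehlerDifferential.D M F (b k)))⁻¹ • g ∘ₗ KaehlerDifferential.map ℤ M F F,
    by simp [hg], fun j hj => ?_⟩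
  have hmem : b j ∈ M := hLM (IntermediateField.subset_adjoin _ _ ⟨j, hj, rfl⟩)
  have h0 : KaehlerDifferential.D M F (b j) = 0 :=
    (KaehlerDifferential.D M F).map_algebraMap ⟨b j, hmem⟩
  simp [h0]

theorem ExteriorAlgebra.contractLeft_mem_exteriorPower {R M : Type*} [CommRing R] [AddCommGroup M]
    [Module R M] (d : Module.Dual R M) (n : ℕ) {w : ExteriorAlgebra R M}
    (hw : w ∈ ⋀[R]^(n + 1) M) : CliffordAlgebra.contractLeft (Q := 0) d w ∈ ⋀[R]^n M := by
  induction n generalizing w with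
  | zero =>
    rw [exteriorPower, zero_add, pow_one] at hw
    obtain ⟨m, rfl⟩ := hw
    rw [exteriorPower, pow_zero, ExteriorAlgebra.ι, CliffordAlgebra.contractLeft_ι]
    exact Submodule.algebraMap_mem _
  | succ n ih =>
    rw [exteriorPower, pow_succ'] at hw
    refine Submodule.mul_induction_on hw ?_ fun x y hx hy => ?_
    · rintro _ ⟨m, rfl⟩ y hy
      rw [ExteriorAlgebra.ι, CliffordAlgebra.contractLeft_ι_mul]
      refine Submodule.sub_mem _ (Submodule.smul_mem _ _ hy) ?_
      rw [exteriorPower, pow_succ']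
      exact Submodule.mul_mem_mul ⟨m, rfl⟩ (ih hy)
    · rw [map_add]
      exact Submodule.add_mem _ hx hy

theorem contractLeft_mem_OmegaPow {F : Type} [Field F] (f : Module.Dual F (Ω[F⁄ℤ])) (n : ℤ)
    {w : ExtOmega F} (hw : w ∈ OmegaPow F n) :
    CliffordAlgebra.contractLeft (Q := 0) f w ∈ OmegaPow F (n - 1) := by
  rcases lt_trichotomy n 0 with hn | rfl | hn
  · rw [OmegaPow, if_neg hn.not_ge, Submodule.mem_bot] at hw
    rw [hw, map_zero]
    exact Submodule.zero_mem _
  · rw [OmegaPow, if_pos le_rfl, Int.toNat_zero, exteriorPower, pow_zero, Submodule.mem_one] at hw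
    obtain ⟨c, rfl⟩ := hw
    have h : CliffordAlgebra.contractLeft (Q := 0) f (algebraMap F (ExtOmega F) c) = 0 :=
      CliffordAlgebra.contractLeft_algebraMap _ _ _
    rw [h]
    exact Submodule.zero_mem _
  · obtain ⟨m, rfl⟩ : ∃ m : ℕ, n = m + 1 := ⟨(n - 1).toNat, by omega⟩
    rw [OmegaPow, if_pos hn.le] at hw
    rw [add_sub_cancel_right, OmegaPow, if_pos (Int.natCast_nonneg m), Int.toNat_natCast]
    exact ExteriorAlgebra.contractLeft_mem_exteriorPower f m hw

theorem contractLeft_dform_mul {F : Type} [Field F] (f : Module.Dual F (Ω[F⁄ℤ])) (a : F)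
    (w : ExtOmega F) :
    CliffordAlgebra.contractLeft (Q := 0) f (dform F a * w) =
      f (KaehlerDifferential.D ℤ F a) • w -
        dform F a * CliffordAlgebra.contractLeft (Q := 0) f w :=
  CliffordAlgebra.contractLeft_ι_mul _ _ _

theorem eq_dform_mul_contractLeft {F : Type} [Field F] {f : Module.Dual F (Ω[F⁄ℤ])} {a : F}
    (hf : f (KaehlerDifferential.D ℤ F a) = 1) {w : ExtOmega F} (hw : dform F a * w = 0) :
    w = dform F a * CliffordAlgebra.contractLeft (Q := 0) f w := by
  have h := contractLeft_dform_mul f a w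
  rw [hw, map_zero, hf, one_smul] at h
  exact sub_eq_zero.mp h.symm

theorem exists_eq_dwedge_mul {F : Type} [Field F] {r : ℕ} (b : Fin r → F)
    (f : Fin r → Module.Dual F (Ω[F⁄ℤ]))
    (hf : ∀ i, f i (KaehlerDifferential.D ℤ F (b i)) = 1)
    (hf' : ∀ i j, j ≠ i → f i (KaehlerDifferential.D ℤ F (b j)) = 0) (n : ℤ)
    {w : ExtOmega F} (hw : w ∈ OmegaPow F n) (h : ∀ i, dform F (b i) * w = 0) :
    ∃ v ∈ OmegaPow F (n - r), w = dwedge F b * v := by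
  induction r generalizing n w with
  | zero => exact ⟨w, by simpa using hw, by simp [dwedge]⟩
  | succ r ih =>
    obtain ⟨v, hv, hwv⟩ := ih (fun i => b i.succ) (fun i => f i.succ) (fun i => hf _)
      (fun i j hij => hf' _ _ (by simpa using hij)) (n - 1)
      (contractLeft_mem_OmegaPow (f 0) n hw) (fun i => by
        have := contractLeft_dform_mul (f 0) (b i.succ) w
        rw [h, map_zero, hf' 0 _ (Fin.succ_ne_zero i), zero_smul, zero_sub] at this
        exact neg_eq_zero.mp this.symm)
    refine ⟨v, ?_, ?_⟩
    · convert hv using 2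
      push_cast
      ring
    · rw [eq_dform_mul_contractLeft (hf 0) (h 0), hwv]
      simp only [dwedge, List.ofFn_succ, List.prod_cons, mul_assoc]

theorem dform_mul_dform_self {F : Type} [Field F] (a : F) : dform F a * dform F a = 0 :=
  ExteriorAlgebra.ι_sq_zero _

theorem dform_mul_dwedge {F : Type} [Field F] {r : ℕ} (b : Fin r → F) (i : Fin r) :
    dform F (b i) * dwedge F b = 0 :=
  ExteriorAlgebra.ι_mul_prod_list (fun j => KaehlerDifferential.D ℤ F (b j)) i

/-- Lemma 2.2. For a `p`-independent family `{b₁, …, b_r}` and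
`ω ∈ Ωⁿ(F)`: `d bᵢ ∣ ω` for all `i` if and only if `d b₁ ∧ … ∧ d b_r ∣ ω`, where
`η ∣ ω` for `η ∈ Ω^s(F)` means `ω = η ∧ v` for some `v ∈ Ω^{n−s}(F)`. -/
theorem stmt3 (F : Type) [Field F] (p : ℕ) [Fact p.Prime] [CharP F p]
    (n : ℕ) (r : ℕ) (b : Fin r → F) (hb : pIndep F p b)
    (ω : ExtOmega F) (hω : ω ∈ OmegaPow F n) :
    (∀ i, ∃ v ∈ OmegaPow F ((n : ℤ) - 1), ω = dform F (b i) * v) ↔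
      ∃ v ∈ OmegaPow F ((n : ℤ) - r), ω = dwedge F b * v := by
  choose f hf hf' using hb.exists_dual
  constructor
  · intro h
    refine exists_eq_dwedge_mul b f hf hf' n hω fun i => ?_
    obtain ⟨v, -, hv⟩ := h i
    rw [hv, ← mul_assoc, dform_mul_dform_self, zero_mul]
  · rintro ⟨v, -, hv⟩ i
    refine ⟨_, contractLeft_mem_OmegaPow (f i) n hω, eq_dform_mul_contractLeft (hf i) ?_⟩
    rw [hv, ← mul_assoc, dform_mul_dwedge, zero_mul]
end

section
/- Let F be a field of characteristic p > 0 and let S_1, ..., S_r ⊆ F be nonempty sets. Then annΩ^n_F(dS_1 ∧ ... ∧ dS_r) = annΩ^n_F(d(F^p(S_1)) ∧ ... ∧ d(F^p(S_r))), where F^p(S_i) is the subfield of F generated by F^p and S_i. -/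
set_option synthInstance.maxHeartbeats 1000000
set_option maxHeartbeats 1000000

open ExteriorAlgebra

/-- The product of a family of elements of spans lies in the span of the products. -/
theorem list_prod_ofFn_mem_span {R A : Type*} [CommSemiring R] [Semiring A] [Algebra R A] {r : ℕ}
    (T : Fin r → Set A) (v : Fin r → A) (hv : ∀ i, v i ∈ Submodule.span R (T i)) :
    (List.ofFn v).prod ∈
      Submodule.span R {x | ∃ t : Fin r → A, (∀ i, t i ∈ T i) ∧ x = (List.ofFn t).prod} := by
  induction r with
  | zero => exact Submodule.subset_span ⟨v, fun i => i.elim0, rfl⟩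
  | succ r ih =>
    rw [List.ofFn_succ, List.prod_cons]
    have h := Submodule.mul_mem_mul (hv 0)
      (ih (fun i => T i.succ) (fun i => v i.succ) fun i => hv i.succ)
    rw [Submodule.span_mul_span] at h
    refine Submodule.span_mono ?_ h
    rintro _ ⟨a, ha, _, ⟨t, ht, rfl⟩, rfl⟩
    refine ⟨Fin.cons a t, fun i => ?_, by simp [List.ofFn_succ]⟩
    refine Fin.cases ?_ (fun j => ?_) i
    · simpa using ha
    · simpa using ht j

/-- The differential of an element of `F^p(C)` is a linear combination of the `d c`, `c ∈ C`. -/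
theorem dform_mem_span_of_mem_pClosure (F : Type) [Field F] (p : ℕ) [CharP F p]
    (C : Set F) {a : F} (ha : a ∈ pClosure F p C) :
    dform F a ∈ Submodule.span F (dform F '' C) := by
  unfold pClosure pClosureT at ha
  induction ha using Subfield.closure_induction with
  | mem x hx =>
    rcases hx with ⟨y, rfl⟩ | hx
    · have : dform F (y ^ p ^ 1) = 0 := by
        simp [dform, Derivation.leibniz_pow, ← Nat.cast_smul_eq_nsmul F]
      simp only [this, zero_mem]
    · exact Submodule.subset_span ⟨x, hx, rfl⟩
  | one => simp [dform]
  | add x y _ _ hx hy =>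
    have : dform F (x + y) = dform F x + dform F y := by simp [dform]
    rw [this]
    exact add_mem hx hy
  | neg x _ hx =>
    have : dform F (-x) = -dform F x := by simp [dform]
    rw [this]
    exact neg_mem hx
  | inv x _ hx =>
    have : dform F x⁻¹ = (-x⁻¹ ^ 2) • dform F x := by
      rw [dform, Derivation.leibniz_inv, map_smul, dform]
    rw [this]
    exact Submodule.smul_mem _ _ hx
  | mul x y _ _ hx hy =>
    have : dform F (x * y) = x • dform F y + y • dform F x := by
      simp [dform, Derivation.leibniz]
    rw [this]
    exact add_mem (Submodule.smul_mem _ _ hy) (Submodule.smul_mem _ _ hx)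

/-- The annihilator of a set of forms is antitone with respect to the spans of the sets. -/
theorem annOmega_le_of_subset_span (F : Type) [Field F] (n : ℕ) {U V : Set (ExtOmega F)}
    (h : U ⊆ Submodule.span F V) : annOmega F n V ≤ annOmega F n U := by
  refine inf_le_inf_left _ fun ω hω => ?_
  simp only [Submodule.mem_iInf, LinearMap.mem_ker, LinearMap.mulRight_apply] at hω ⊢
  have hV : Submodule.span F V ≤ LinearMap.ker (LinearMap.mulLeft F ω) :=
    Submodule.span_le.2 fun v hv => hω v hv
  exact fun u hu => hV (h hu)

/-- Lemma 3.2(e). For nonempty sets `S₁, …, S_r ⊆ F` one has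
`annΩ^n_F(dS₁ ∧ … ∧ dS_r) = annΩ^n_F(d(F^p(S₁)) ∧ … ∧ d(F^p(S_r)))`. -/
theorem stmt5 (F : Type) [Field F] (p : ℕ) [Fact p.Prime] [CharP F p]
    (n r : ℕ) (S : Fin r → Set F) (hS : ∀ i, (S i).Nonempty) :
    annOmega F n (dSet F S) =
      annOmega F n (dSet F fun i => (pClosure F p (S i) : Set F)) := by
  apply le_antisymm
  · refine annOmega_le_of_subset_span F n ?_
    rintro _ ⟨a, ha, rfl⟩
    refine Submodule.span_mono ?_ (list_prod_ofFn_mem_span (fun i => dform F '' S i) _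
      fun i => dform_mem_span_of_mem_pClosure F p (S i) (ha i))
    rintro _ ⟨t, ht, rfl⟩
    choose s hs hst using ht
    exact ⟨s, hs, by simp only [dwedge, hst]⟩
  · refine annOmega_le_of_subset_span F n fun _ ⟨s, hs, h⟩ => Submodule.subset_span ⟨s, ?_, h⟩
    exact fun i => Subfield.subset_closure (Or.inr (hs i))
end
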